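/- Call an ℓ-flat V ⊆ F_q^{ℓ+n} good if the projection onto the first ℓ coordinates maps V bijectively onto F_q^ℓ (equivalently, V = {(x, Tx) : x ∈ F_q^ℓ} is the graph of some affine map T : F_q^ℓ → F_q^n). If V is a good ℓ-flat, then among all ℓ-flats U ⊆ F_q^{ℓ+n} adjacent to V in AffGras(ℓ+n, ℓ) (i.e., with dim(U ∩ V) = ℓ−1), the fraction of good ones is at least 1 − 1/q. -/

import Mathlib

noncomputable section

open Finset

/-- Affine maps `F^ℓ → F^n`, given as a pair (linear part matrix, translation). -/
abbrev Aff (F : Type) (n ℓ : ℕ) := Matrix (Fin n) (Fin ℓ) F × (Fin n → F)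

/-- Application of an affine map `T = (M, c)`: `x ↦ Mx + c`. -/
def affApp {F : Type} [Field F] {n ℓ : ℕ} (T : Aff F n ℓ) (x : Fin ℓ → F) : Fin n → F :=
  T.1.mulVec x + T.2

/-- Inner product of two functions `F^m → F`. -/
def ip {F : Type} [Field F] [Fintype F] {m : ℕ} (u v : (Fin m → F) → F) : F :=
  ∑ z : Fin m → F, u z * v z

/-- `g` has degree at most `d` as a function. -/
def fDegLE {F : Type} [Field F] {m : ℕ} (g : (Fin m → F) → F) (d : ℕ) : Prop :=
  ∃ Q : MvPolynomial (Fin m) F, Q.totalDegree ≤ d ∧ ∀ x, MvPolynomial.eval x Q = g x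

/-- The defining equation of the polynomial `P`:
`x_1 ⋯ x_{p-1} · P = ∑_{I ⊆ [p-1]} (-1)^{|I|+1} (x_I + x_p)^{q-1}`. -/
def Pdef {F : Type} [Field F] (p q : ℕ) (hp : 0 < p) (P : MvPolynomial (Fin p) F) : Prop :=
  (∏ i : Fin (p - 1), MvPolynomial.X (Fin.castLE (Nat.sub_le p 1) i)) * P =
    ∑ I : Finset (Fin (p - 1)),
      MvPolynomial.C ((-1 : F) ^ (I.card + 1)) *
        ((∑ i ∈ I, MvPolynomial.X (Fin.castLE (Nat.sub_le p 1) i)) +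
          MvPolynomial.X (⟨p - 1, Nat.sub_lt hp one_pos⟩ : Fin p)) ^ (q - 1)

/-- The test polynomial `H_e` as a function on `F^{s+t}`. -/
def Hfun {F : Type} [Field F] {p : ℕ} (P : MvPolynomial (Fin p) F)
    (s t : ℕ) (e : Fin t → ℕ) (x : Fin (s + t) → F) : F :=
  (∏ i ∈ Finset.range (s / p),
    MvPolynomial.eval (fun l : Fin p =>
      if h : p * i + (l : ℕ) < s + t then x ⟨p * i + (l : ℕ), h⟩ else 0) P) *
  ∏ j : Fin t, x (Fin.natAdd s j) ^ e j

/-- A degree sequence `e ∈ {0, …, q-1}^t` is valid if `∑ e_j ≤ t(q-1) - r`. -/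
def validE (q r t : ℕ) (e : Fin t → ℕ) : Prop :=
  (∀ j, e j ≤ q - 1) ∧ ∑ j, e j ≤ t * (q - 1) - r

/-- `T` rejects `f` in the sparse `(s+t)`-flat test. -/
def rejects {F : Type} [Field F] [Fintype F] {p : ℕ} (P : MvPolynomial (Fin p) F)
    (q s r t n : ℕ) (f : (Fin n → F) → F) (T : Aff F n (s + t)) : Prop :=
  ∃ e : Fin t → ℕ, validE q r t e ∧ ip (fun x => f (affApp T x)) (Hfun P s t e) ≠ 0

/-- Density of `A` inside `C`. -/
def dens {α : Type} (A C : Set α) : ℝ :=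
  (Nat.card ↥(A ∩ C) : ℝ) / (Nat.card ↥C : ℝ)

/-- Fractional measure of a set in a (finite) type. -/
def mu {α : Type} (A : Set α) : ℝ :=
  (Nat.card ↥A : ℝ) / (Nat.card α : ℝ)

/-- The union of the supports of the test polynomials `H_e`. -/
def suppH {F : Type} [Field F] [Fintype F] {p : ℕ} (P : MvPolynomial (Fin p) F)
    (q s t : ℕ) : Set (Fin (s + t) → F) :=
  {x | ∃ e : Fin t → ℕ, (∀ j, e j ≤ q - 1) ∧ Hfun P s t e x ≠ 0}

/-- Edge expansion of a set `S` in the (regular) graph with adjacency `adj`: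
the probability that a uniformly random step started in `S` escapes `S`. -/
def expans {α : Type} (adj : α → α → Prop) (S : Set α) : ℝ :=
  (Nat.card {x : α × α // x.1 ∈ S ∧ adj x.1 x.2 ∧ x.2 ∉ S} : ℝ) /
  (Nat.card {x : α × α // x.1 ∈ S ∧ adj x.1 x.2} : ℝ)

/-- Adjacency in the affine bi-linear scheme graph: two distinct affine maps are adjacent
iff their agreement set is an affine subspace of dimension `ℓ - 1`. -/
def adjBilin {F : Type} [Field F] {n ℓ : ℕ} (T₁ T₂ : Aff F n ℓ) : Prop :=
  T₁ ≠ T₂ ∧ ∃ W : AffineSubspace F (Fin ℓ → F),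
    (W : Set (Fin ℓ → F)).Nonempty ∧
    (W : Set (Fin ℓ → F)) = {x | affApp T₁ x = affApp T₂ x} ∧
    Module.finrank F W.direction = ℓ - 1

/-- `W` is an `ℓ`-flat: a nonempty affine subspace of dimension `ℓ`. -/
def IsFlat {F : Type} [Field F] {N : ℕ} (ℓ : ℕ) (W : AffineSubspace F (Fin N → F)) : Prop :=
  (W : Set (Fin N → F)).Nonempty ∧ Module.finrank F W.direction = ℓ

/-- Adjacency in the affine Grassmann graph `AffGras(N, ℓ)`: two distinct `ℓ`-flats are
adjacent iff their intersection is an `(ℓ-1)`-flat. -/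
def adjGras {F : Type} [Field F] {N : ℕ} (ℓ : ℕ) (U V : AffineSubspace F (Fin N → F)) : Prop :=
  U ≠ V ∧ IsFlat ℓ U ∧ IsFlat ℓ V ∧ IsFlat (ℓ - 1) (U ⊓ V)

/-- The minimal fractional Hamming distance from `f` to a function of degree at most `d`. -/
def deltaDist {F : Type} [Field F] [Fintype F] {n : ℕ} (f : (Fin n → F) → F) (d : ℕ) : ℝ :=
  sInf {x : ℝ | ∃ g : (Fin n → F) → F, fDegLE g d ∧
    x = (Nat.card {y : Fin n → F // f y ≠ g y} : ℝ) / (Fintype.card (Fin n → F) : ℝ)}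

open Module in
/-- Adjoining to a hyperplane of `V` a direction outside `V` gives a neighbor of `V`. -/
theorem adjGras_mk'_sup_span {F : Type} [Field F] {N ℓ : ℕ} (hℓ : 1 ≤ ℓ)
    {V : AffineSubspace F (Fin N → F)} (hV : IsFlat ℓ V) {a x : Fin N → F} (ha : a ∈ V)
    {W : Submodule F (Fin N → F)} (hW : W ≤ V.direction) (hWd : finrank F W = ℓ - 1)
    (hx : x ∉ V.direction) :
    V.direction ⊓ (W ⊔ F ∙ x) = W ∧ adjGras ℓ V (AffineSubspace.mk' a (W ⊔ F ∙ x)) := by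
  have hinf : V.direction ⊓ (W ⊔ F ∙ x) = W := by
    refine le_antisymm ?_ (le_inf hW le_sup_left)
    rintro y ⟨hyV, hy⟩
    obtain ⟨w, hw, z, hz, rfl⟩ := Submodule.mem_sup.1 hy
    obtain ⟨c, rfl⟩ := Submodule.mem_span_singleton.1 hz
    have hcx : c • x ∈ V.direction := (Submodule.add_mem_iff_right _ (hW hw)).1 hyV
    have hc : c = 0 := by
      by_contra hc
      exact hx ((Submodule.smul_mem_iff _ hc).1 hcx)
    simpa [hc] using hw
  have hxW : x ∉ W := fun h => hx (hW h)
  have hdim : finrank F ↥(W ⊔ F ∙ x) = ℓ := by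
    have h := Submodule.finrank_sup_add_finrank_inf_eq W (F ∙ x)
    have hx0 : x ≠ 0 := fun h => hx (h ▸ zero_mem _)
    have hbot : W ⊓ F ∙ x = ⊥ := by
      rw [← disjoint_iff]
      exact (Submodule.disjoint_span_singleton' hx0).2 hxW
    rw [hbot, finrank_bot, finrank_span_singleton hx0] at h
    omega
  have hdir : (V ⊓ AffineSubspace.mk' a (W ⊔ F ∙ x)).direction = W := by
    rw [AffineSubspace.direction_inf_of_mem ha (AffineSubspace.self_mem_mk' _ _),
      AffineSubspace.direction_mk', hinf]
  refine ⟨hinf, ?_, hV, ⟨⟨a, AffineSubspace.self_mem_mk' _ _⟩, ?_⟩,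
    ⟨a, ha, AffineSubspace.self_mem_mk' _ _⟩, ?_⟩
  · intro h
    rw [← h, inf_idem] at hdir
    have := hV.2
    rw [hdir] at this
    omega
  · rw [AffineSubspace.direction_mk', hdim]
  · rw [hdir, hWd]

open Module in
/-- An `ℓ`-flat projects bijectively to `F^ℓ` as soon as its direction meets the kernel of the
projection trivially. -/
theorem IsFlat.bijOn_of_disjoint_ker {F : Type} [Field F] {N ℓ : ℕ}
    {U : AffineSubspace F (Fin N → F)} (hU : IsFlat ℓ U)
    (π : (Fin N → F) →ₗ[F] (Fin ℓ → F)) (h : ∀ d ∈ U.direction, π d = 0 → d = 0) :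
    Set.BijOn π (U : Set (Fin N → F)) Set.univ := by
  obtain ⟨⟨a, ha⟩, hd⟩ := hU
  refine ⟨fun _ _ => Set.mem_univ _, fun x hx y hy hxy => ?_, fun y _ => ?_⟩
  · exact sub_eq_zero.1 (h _ (AffineSubspace.vsub_mem_direction hx hy)
      (by simpa [sub_eq_zero] using hxy))
  · have hinj : Function.Injective (π.domRestrict U.direction) :=
      (injective_iff_map_eq_zero _).2 fun d hd0 => Subtype.ext (h d d.2 hd0)
    have hsurj := (LinearMap.injective_iff_surjective_of_finrank_eq_finrank
      (by rw [hd, finrank_fin_fun])).1 hinj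
    obtain ⟨d, hd⟩ := hsurj (y - π a)
    refine ⟨(d : Fin N → F) + a, AffineSubspace.vadd_mem_of_mem_direction d.2 ha, ?_⟩
    have hd' : π d = y - π a := hd
    simp [hd']

open Module in
/-- If `V` projects bijectively to `F^ℓ`, then at most one in `|F|` of the neighbors of `V` fails
to do so. -/
theorem card_mul_card_bad_le {F : Type} [Field F] [Fintype F] {N ℓ : ℕ} (hℓ : 1 ≤ ℓ)
    {V : AffineSubspace F (Fin N → F)} (hV : IsFlat ℓ V)
    (π : (Fin N → F) →ₗ[F] (Fin ℓ → F)) (hπ : Set.InjOn π (V : Set (Fin N → F))) :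
    Nat.card ↥{U | adjGras ℓ V U ∧ ¬ Set.BijOn π (U : Set (Fin N → F)) Set.univ} *
      Nat.card F ≤ Nat.card ↥{U | adjGras ℓ V U} := by
  have hker : ∀ d ∈ V.direction, π d = 0 → d = 0 := by
    intro d hd h0
    obtain ⟨a, ha⟩ := hV.1
    have := hπ (AffineSubspace.vadd_mem_of_mem_direction hd ha) ha (by simp [h0])
    simpa using this
  have hv : ∀ W : Submodule F (Fin N → F), finrank F W = ℓ - 1 →
      ∃ v ∈ V.direction, v ∉ W := by
    intro W hW
    refine SetLike.not_le_iff_exists.1 fun hle => ?_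
    have := Submodule.finrank_mono hle
    rw [hV.2, hW] at this
    omega
  choose! v hvV hvW using hv
  have hbad : ∀ U : {U | adjGras ℓ V U ∧ ¬ Set.BijOn π (U : Set (Fin N → F)) Set.univ},
      ∃ a d : Fin N → F, a ∈ V ∧ π d = 0 ∧ d ≠ 0 ∧
        finrank F ↥(V.direction ⊓ U.1.direction) = ℓ - 1 ∧
        U.1 = AffineSubspace.mk' a ((V.direction ⊓ U.1.direction) ⊔ F ∙ d) := by
    rintro ⟨U, ⟨-, -, hU, ⟨a, haV, haU⟩, hdim⟩, hnot⟩
    have hex : ∃ d ∈ U.direction, π d = 0 ∧ d ≠ 0 := by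
      by_contra! h
      exact hnot (hU.bijOn_of_disjoint_ker π h)
    obtain ⟨d, hdU, hd, hd0⟩ := hex
    rw [AffineSubspace.direction_inf_of_mem haV haU] at hdim
    refine ⟨a, d, haV, hd, hd0, hdim, ?_⟩
    have hadj := (adjGras_mk'_sup_span hℓ hV haV inf_le_left hdim
      (fun h => hd0 (hker d h hd))).2.2.2.1.2
    rw [AffineSubspace.direction_mk'] at hadj
    have heq : (V.direction ⊓ U.direction) ⊔ F ∙ d = U.direction :=
      Submodule.eq_of_le_of_finrank_eq
        (sup_le inf_le_right ((Submodule.span_singleton_le_iff_mem _ _).2 hdU))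
        (by rw [hadj, hU.2])
    simp only
    rw [heq, AffineSubspace.mk'_eq haU]
  choose a d haV hd hd0 hdim hUeq using hbad
  have hout : ∀ U (c : F), d U + c • v (V.direction ⊓ U.1.direction) ∉ V.direction := by
    intro U c h
    exact hd0 U (hker _ ((Submodule.add_mem_iff_left _
      (Submodule.smul_mem _ _ (hvV _ (hdim U)))).1 h) (hd U))
  rw [← Nat.card_prod]
  refine Nat.card_le_card_of_injective (fun x => ⟨AffineSubspace.mk' (a x.1)
    ((V.direction ⊓ x.1.1.direction) ⊔
      F ∙ (d x.1 + x.2 • v (V.direction ⊓ x.1.1.direction))),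
    (adjGras_mk'_sup_span hℓ hV (haV x.1) inf_le_left (hdim x.1) (hout x.1 x.2)).2⟩) ?_
  rintro ⟨U₁, c₁⟩ ⟨U₂, c₂⟩ h
  replace h := Subtype.ext_iff.1 h
  simp only at h
  have hdir := congrArg AffineSubspace.direction h
  simp only [AffineSubspace.direction_mk'] at hdir
  have hinf := fun U c => (adjGras_mk'_sup_span hℓ hV (haV U) inf_le_left (hdim U)
    (hout U c)).1
  have hW : V.direction ⊓ U₁.1.direction = V.direction ⊓ U₂.1.direction := by
    rw [← hinf U₁ c₁, hdir, hinf U₂ c₂]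
  have ha : a U₁ -ᵥ a U₂ ∈ V.direction ⊓ U₂.1.direction := by
    rw [← hinf U₂ c₂]
    refine ⟨AffineSubspace.vsub_mem_direction (haV _) (haV _), ?_⟩
    rw [SetLike.mem_coe, ← AffineSubspace.mem_mk', ← h]
    exact AffineSubspace.self_mem_mk' _ _
  have hmem : d U₁ + c₁ • v (V.direction ⊓ U₁.1.direction) ∈ (V.direction ⊓ U₂.1.direction) ⊔
      F ∙ (d U₂ + c₂ • v (V.direction ⊓ U₂.1.direction)) := by
    rw [← hdir]
    exact Submodule.mem_sup_right (Submodule.mem_span_singleton_self _)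
  rw [hW] at hmem
  obtain ⟨w, hw, z, hz, hsum⟩ := Submodule.mem_sup.1 hmem
  obtain ⟨r, rfl⟩ := Submodule.mem_span_singleton.1 hz
  have hvW₂ := hvW _ (hdim U₂)
  have hvV₂ := hvV _ (hdim U₂)
  set u := v (V.direction ⊓ U₂.1.direction)
  have hdiff : d U₁ - r • d U₂ = w + (r * c₂ - c₁) • u := by
    rw [sub_eq_iff_eq_add, ← add_left_inj (c₁ • u), ← hsum]
    module
  have hd12 : d U₁ - r • d U₂ = 0 := by
    refine hker _ ?_ (by simp [hd])
    rw [hdiff]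
    exact add_mem hw.1 (Submodule.smul_mem _ _ hvV₂)
  have hc : r * c₂ - c₁ = 0 := by
    by_contra hc
    rw [hd12] at hdiff
    refine hvW₂ ((Submodule.smul_mem_iff _ hc).1 ?_)
    rw [← neg_eq_of_add_eq_zero_right hdiff.symm]
    exact neg_mem hw
  have hr : r ≠ 0 := by
    rintro rfl
    exact hd0 U₁ (by simpa using hd12)
  have hU : U₁ = U₂ := by
    refine Subtype.ext ?_
    rw [hUeq U₁, hUeq U₂, hW, sub_eq_zero.1 hd12,
      Submodule.span_singleton_smul_eq (IsUnit.mk0 r hr)]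
    refine AffineSubspace.ext_of_direction_eq (by simp only [AffineSubspace.direction_mk'])
      ⟨a U₁, AffineSubspace.self_mem_mk' _ _, ?_⟩
    rw [SetLike.mem_coe, AffineSubspace.mem_mk']
    exact Submodule.mem_sup_left ha
  subst hU
  have hr1 : r = 1 := by
    have : (1 - r) • d U₁ = 0 := by rw [sub_smul, one_smul, hd12]
    rcases smul_eq_zero.1 this with h | h
    · exact (sub_eq_zero.1 h).symm
    · exact absurd h (hd0 U₁)
  rw [hr1, one_mul, sub_eq_zero] at hc
  rw [hc]

open Module in
/-- A flat that is not the whole space has a neighbor. -/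
theorem exists_adjGras {F : Type} [Field F] {N ℓ : ℕ} (hℓ : 1 ≤ ℓ) (hN : ℓ < N)
    {V : AffineSubspace F (Fin N → F)} (hV : IsFlat ℓ V) : ∃ U, adjGras ℓ V U := by
  obtain ⟨a, ha⟩ := hV.1
  obtain ⟨x, hx⟩ : ∃ x, x ∉ V.direction := by
    by_contra! h
    have h1 := hV.2
    rw [Submodule.eq_top_iff'.2 h, finrank_top, finrank_fin_fun] at h1
    omega
  obtain ⟨f, hf⟩ := exists_linearIndependent_of_le_finrank (R := F) (M := V.direction)
    (n := ℓ - 1) (by rw [hV.2]; exact Nat.sub_le _ _)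
  have hf' := hf.map' V.direction.subtype (Submodule.ker_subtype _)
  refine ⟨_, (adjGras_mk'_sup_span hℓ hV ha (Submodule.span_le.2 ?_)
    ((finrank_span_eq_card hf').trans (Fintype.card_fin _)) hx).2⟩
  rintro _ ⟨i, rfl⟩
  exact (f i).2

/-- Call an `ℓ`-flat `V ⊆ F_q^{ℓ+n}` good if the projection to the first `ℓ`
coordinates maps `V` bijectively onto `F_q^ℓ`. If `V` is a good `ℓ`-flat, then at least a
`1 - 1/q` fraction of the neighbors of `V` in `AffGras(ℓ+n, ℓ)` are good. -/
theorem good_flats_neighbors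
    (p k : ℕ) (hp : p.Prime) (hk : 1 ≤ k)
    (F : Type) [Field F] [Fintype F]
    (q : ℕ) (hq : q = p ^ k) (hcard : Fintype.card F = q)
    (n ℓ : ℕ) (hn : 1 ≤ n) (hℓ : 1 ≤ ℓ)
    (V : AffineSubspace F (Fin (ℓ + n) → F)) (hV : IsFlat ℓ V)
    (hgood : Set.BijOn (fun z : Fin (ℓ + n) → F => fun i : Fin ℓ => z (Fin.castAdd n i))
      (V : Set (Fin (ℓ + n) → F)) Set.univ) :
    1 - 1 / (q : ℝ) ≤
      dens {U : AffineSubspace F (Fin (ℓ + n) → F) |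
            Set.BijOn (fun z : Fin (ℓ + n) → F => fun i : Fin ℓ => z (Fin.castAdd n i))
              (U : Set (Fin (ℓ + n) → F)) Set.univ}
        {U : AffineSubspace F (Fin (ℓ + n) → F) | adjGras ℓ V U} := by
  subst hcard
  let π : (Fin (ℓ + n) → F) →ₗ[F] (Fin ℓ → F) := LinearMap.funLeft F F (Fin.castAdd n)
  change Set.BijOn π _ _ at hgood
  change _ ≤ dens {U : AffineSubspace F (Fin (ℓ + n) → F) |
    Set.BijOn π (U : Set (Fin (ℓ + n) → F)) Set.univ} _
  have hbad := card_mul_card_bad_le hℓ hV π hgood.injOn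
  obtain ⟨U₀, hU₀⟩ := exists_adjGras hℓ (by omega : ℓ < ℓ + n) hV
  set A := {U : AffineSubspace F (Fin (ℓ + n) → F) |
    Set.BijOn π (U : Set (Fin (ℓ + n) → F)) Set.univ}
  set C := {U : AffineSubspace F (Fin (ℓ + n) → F) | adjGras ℓ V U}
  have hsplit : Nat.card ↥(A ∩ C) + Nat.card ↥(C \ A) = Nat.card ↥C := by
    simp only [Nat.card_coe_set_eq]
    rw [Set.inter_comm]
    exact Set.ncard_inter_add_ncard_sdiff_eq_ncard C A
  have hpos : 0 < Nat.card ↥C := by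
    have : Nonempty ↥C := ⟨⟨U₀, hU₀⟩⟩
    exact Nat.card_pos
  have hq0 : 0 < Nat.card F := Nat.card_pos
  change Nat.card ↥(C \ A) * _ ≤ _ at hbad
  rw [← Nat.card_eq_fintype_card, _root_.dens, le_div_iff₀ (by exact_mod_cast hpos)]
  have hsplit' : (Nat.card ↥(A ∩ C) : ℝ) + Nat.card ↥(C \ A) = Nat.card ↥C := by
    exact_mod_cast hsplit
  have hbad' : (Nat.card ↥(C \ A) : ℝ) ≤ Nat.card ↥C / Nat.card F := by
    rw [le_div_iff₀ (by exact_mod_cast hq0)]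
    exact_mod_cast hbad
  rw [sub_mul, one_mul, one_div_mul_eq_div]
  linarith

end
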